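/- arXiv:1403.2056 — 2 statements merged into one kernel-verified Lean document; each statement's English description precedes it below -/
import Mathlib

section
/- Binary LCP-merge is correct: given two lexicographically sorted sequences of strings S_1 and S_2 together with their LCP arrays H_1 and H_2, the binary LCP-merge procedure (which repeatedly applies binary LCP-compare to the front strings of the two sequences, using as reference string p the previously output string, outputs the smaller string together with the computed LCP, and updates the stored LCP values accordingly) outputs the sorted merge S_0 of S_1 and S_2 (a sorted permutation of the concatenation of S_1 and S_2) together with the correct LCP array H_0 of S_0. -/
/-- The length of the longest common prefix of two lists. -/
def lcp {α : Type*} [DecidableEq α] : List α → List α → ℕ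
  | a :: s, b :: t => if a = b then lcp s t + 1 else 0
  | _, _ => 0

/-- Annotate each string of a sequence, starting from predecessor `p`, with the
LCP to its predecessor. -/
def annotateFrom {α : Type*} [DecidableEq α] (p : List α) :
    List (List α) → List (List α × ℕ)
  | [] => []
  | s :: rest => (s, lcp p s) :: annotateFrom s rest

/-- Annotate each string of a sorted sequence with its LCP array: each string is
paired with the LCP to its predecessor, the first string getting the value `0`
(its predecessor being the empty string ε). -/
def annotate {α : Type*} [DecidableEq α] : List (List α) → List (List α × ℕ)
  | [] => []
  | s :: rest => (s, 0) :: annotateFrom s rest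

/-- Binary LCP-compare: given two strings `a`, `b` with LCP values `ha = lcp p a`,
`hb = lcp p b` to a common smaller predecessor `p`, it returns whether the first
string wins (is ≤) together with the LCP of `a` and `b` (for the loser):
if `ha ≠ hb` the string with the larger LCP is the winner and `lcp a b = min ha hb`;
if `ha = hb` the characters from position `ha + 1` onward are compared. -/
def lcpCompare {α : Type*} [LinearOrder α] (a : List α) (ha : ℕ) (b : List α)
    (hb : ℕ) : Bool × ℕ :=
  if ha = hb then (decide (a ≤ b), ha + lcp (a.drop ha) (b.drop ha))
  else if hb < ha then (true, hb) else (false, ha)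

/-- Binary LCP-merge: repeatedly applies binary LCP-compare to the front strings of
the two annotated sequences (using as reference string the previously output string),
outputs the winner together with its LCP value, and updates the loser's stored LCP
value to the computed LCP of the two compared strings. -/
def lcpMerge {α : Type*} [LinearOrder α] :
    List (List α × ℕ) → List (List α × ℕ) → List (List α × ℕ)
  | [], ys => ys
  | xs, [] => xs
  | (a, ha) :: xs, (b, hb) :: ys =>
    let c := lcpCompare a ha b hb
    if c.1 then (a, ha) :: lcpMerge xs ((b, c.2) :: ys)
    else (b, hb) :: lcpMerge ((a, c.2) :: xs) ys
termination_by xs ys => xs.length + ys.length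

theorem strLe_iff_aux {α : Type*} [LinearOrder α] (s t : List α) :
    s ≤ t ↔ ¬ List.Lex (· < ·) t s := by
  rw [← not_lt]; rfl

theorem nil_strLe_aux {α : Type*} [LinearOrder α] (x : List α) : [] ≤ x := by
  rw [strLe_iff_aux]; simp

theorem not_cons_strLe_nil_aux {α : Type*} [LinearOrder α] (x : α) (p : List α) :
    ¬ x :: p ≤ [] := by
  rw [strLe_iff_aux, not_not]; exact List.Lex.nil

theorem cons_strLe_cons_aux {α : Type*} [LinearOrder α] {x y : α} {p q : List α} :
    x :: p ≤ y :: q ↔ x < y ∨ x = y ∧ p ≤ q := by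
  rw [strLe_iff_aux, strLe_iff_aux]
  constructor
  · intro h
    rcases lt_trichotomy x y with h1 | rfl | h1
    · exact Or.inl h1
    · exact Or.inr ⟨rfl, fun h2 => h (List.Lex.cons h2)⟩
    · exact absurd (List.Lex.rel h1) h
  · rintro (h1 | ⟨rfl, h1⟩) h2
    · cases h2 with
      | cons h => exact lt_irrefl _ h1
      | rel h => exact lt_asymm h1 h
    · cases h2 with
      | cons h => exact h1 h
      | rel h => exact lt_irrefl _ h

theorem lcp_comm_aux {α : Type*} [DecidableEq α] :
    ∀ s t : List α, lcp s t = lcp t s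
  | [], [] => rfl
  | [], _ :: _ => by simp [lcp]
  | _ :: _, [] => by simp [lcp]
  | a :: s, b :: t => by
    have ih := lcp_comm_aux s t
    by_cases h : a = b
    · simp [lcp, h, ih]
    · simp [lcp, h, Ne.symm h]

theorem lcp_lt_aux {α : Type*} [LinearOrder α] :
    ∀ p a b : List α, p ≤ b → lcp p b < lcp p a →
      a ≤ b ∧ lcp a b = lcp p b
  | [], a, b, _, h => by simp [lcp] at h
  | x :: p, [], b, _, h => by simp [lcp] at h
  | x :: p, y :: a, [], hb, h => absurd hb (not_cons_strLe_nil_aux x p)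
  | x :: p, y :: a, z :: b, hb, h => by
    by_cases hxy : x = y
    · subst hxy
      by_cases hxz : x = z
      · subst hxz
        have hb' : p ≤ b := by simpa [cons_strLe_cons_aux] using hb
        have h' : lcp p b < lcp p a := by simpa [lcp] using h
        obtain ⟨h1, h2⟩ := lcp_lt_aux p a b hb' h'
        refine ⟨by simpa [cons_strLe_cons_aux] using h1, by simp [lcp, h2]⟩
      · have hlt : x < z := by
          rcases cons_strLe_cons_aux.1 hb with h1 | h1
          · exact h1
          · exact absurd h1.1 hxz
        exact ⟨cons_strLe_cons_aux.2 (Or.inl hlt), by simp [lcp, hxz]⟩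
    · simp [lcp, hxy] at h

theorem lcp_drop_aux {α : Type*} [DecidableEq α] :
    ∀ (h : ℕ) (p a b : List α), h ≤ lcp p a → h ≤ lcp p b →
      h + lcp (a.drop h) (b.drop h) = lcp a b
  | 0, _, _, _, _, _ => by simp
  | h + 1, [], _, _, ha, _ => by simp [lcp] at ha
  | h + 1, _ :: _, [], _, ha, _ => by simp [lcp] at ha
  | h + 1, _ :: _, _ :: _, [], _, hb => by simp [lcp] at hb
  | h + 1, x :: p, y :: a, z :: b, ha, hb => by
    by_cases hxy : x = y
    · subst hxy
      by_cases hxz : x = z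
      · subst hxz
        have ih := lcp_drop_aux h p a b (by simpa [lcp] using ha) (by simpa [lcp] using hb)
        simp only [List.drop_succ_cons, lcp, if_true]
        omega
      · simp [lcp, hxz] at hb
    · simp [lcp, hxy] at ha

theorem lcpCompare_spec_aux {α : Type*} [LinearOrder α] (p a b : List α)
    (ha : p ≤ a) (hb : p ≤ b) :
    (lcpCompare a (lcp p a) b (lcp p b)).2 = lcp a b ∧
    ((lcpCompare a (lcp p a) b (lcp p b)).1 = true → a ≤ b) ∧
    (¬ (lcpCompare a (lcp p a) b (lcp p b)).1 = true → b ≤ a) := by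
  unfold lcpCompare
  split_ifs with h1 h2
  · refine ⟨lcp_drop_aux _ p a b le_rfl h1.le, by simp, ?_⟩
    intro h
    have h' : ¬ a ≤ b := by simpa using h
    exact le_of_not_ge h'
  · obtain ⟨h3, h4⟩ := lcp_lt_aux p a b hb h2
    exact ⟨h4.symm, fun _ => h3, fun h => absurd rfl h⟩
  · obtain ⟨h3, h4⟩ := lcp_lt_aux p b a ha (by omega)
    refine ⟨by rw [lcp_comm_aux a b]; exact h4.symm, fun h => by simp at h, fun _ => h3⟩

theorem annotateFrom_map_fst_aux {α : Type*} [DecidableEq α] :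
    ∀ (p : List α) (S : List (List α)), (annotateFrom p S).map Prod.fst = S
  | _, [] => rfl
  | p, s :: S => by simp [annotateFrom, annotateFrom_map_fst_aux s S]

theorem annotate_eq_aux {α : Type*} [DecidableEq α] (S : List (List α)) :
    annotate S = annotateFrom [] S := by
  cases S <;> simp [annotate, annotateFrom, lcp]

theorem lcpMerge_annotateFrom_aux {α : Type*} [LinearOrder α] (p : List α)
    (S T : List (List α)) (hS : (p :: S).Pairwise (· ≤ ·)) (hT : (p :: T).Pairwise (· ≤ ·)) :
    ∃ R : List (List α), lcpMerge (annotateFrom p S) (annotateFrom p T) = annotateFrom p R ∧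
      (p :: R).Pairwise (· ≤ ·) ∧ R.Perm (S ++ T) := by
  match S, T, hS, hT with
  | [], T, hS, hT => exact ⟨T, by simp [annotateFrom, lcpMerge], hT, by simp⟩
  | a :: S, [], hS, hT => exact ⟨a :: S, by simp [annotateFrom, lcpMerge], hS, by simp⟩
  | a :: S, b :: T, hS, hT =>
    obtain ⟨hpS, haS⟩ := List.pairwise_cons.1 hS
    obtain ⟨hpT, hbT⟩ := List.pairwise_cons.1 hT
    have hpa : p ≤ a := hpS a (by simp)
    have hpb : p ≤ b := hpT b (by simp)
    obtain ⟨h2, hab, hba⟩ := lcpCompare_spec_aux p a b hpa hpb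
    simp only [annotateFrom]
    rw [lcpMerge]
    simp only [h2]
    split_ifs with hc
    · have hle := hab hc
      have hT' : (a :: b :: T).Pairwise (· ≤ ·) := by
        refine List.pairwise_cons.2 ⟨?_, hbT⟩
        intro x hx
        rcases List.mem_cons.1 hx with rfl | hx
        · exact hle
        · exact le_trans hle ((List.pairwise_cons.1 hbT).1 x hx)
      obtain ⟨R, hR, hs, hp⟩ := lcpMerge_annotateFrom_aux a S (b :: T) haS hT'
      refine ⟨a :: R, ?_, ?_, ?_⟩
      · simpa [annotateFrom] using hR
      · refine List.pairwise_cons.2 ⟨?_, hs⟩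
        intro x hx
        rcases List.mem_cons.1 hx with rfl | hx
        · exact hpa
        · exact le_trans hpa ((List.pairwise_cons.1 hs).1 x hx)
      · exact hp.cons a
    · have hle := hba hc
      have hS' : (b :: a :: S).Pairwise (· ≤ ·) := by
        refine List.pairwise_cons.2 ⟨?_, haS⟩
        intro x hx
        rcases List.mem_cons.1 hx with rfl | hx
        · exact hle
        · exact le_trans hle ((List.pairwise_cons.1 haS).1 x hx)
      obtain ⟨R, hR, hs, hp⟩ := lcpMerge_annotateFrom_aux b (a :: S) T hS' hbT
      refine ⟨b :: R, ?_, ?_, ?_⟩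
      · rw [lcp_comm_aux a b]
        simpa [annotateFrom] using hR
      · refine List.pairwise_cons.2 ⟨?_, hs⟩
        intro x hx
        rcases List.mem_cons.1 hx with rfl | hx
        · exact hpb
        · exact le_trans hpb ((List.pairwise_cons.1 hs).1 x hx)
      · exact (hp.cons b).trans List.perm_middle.symm
termination_by S.length + T.length

/-- Correctness of binary LCP-merge: given two lexicographically sorted sequences of
strings `S₁`, `S₂` together with their LCP arrays (as produced by `annotate`), binary
LCP-merge outputs the sorted merge `S₀` of `S₁` and `S₂` — a sorted permutation of
the concatenation of `S₁` and `S₂` — together with the correct LCP array of `S₀`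
(i.e. the output equals `annotate S₀`). -/
theorem lcpMerge_correct {α : Type*} [LinearOrder α] (S₁ S₂ : List (List α))
    (h₁ : S₁.Pairwise (· ≤ ·)) (h₂ : S₂.Pairwise (· ≤ ·)) :
    ((lcpMerge (annotate S₁) (annotate S₂)).map Prod.fst).Pairwise (· ≤ ·) ∧
    ((lcpMerge (annotate S₁) (annotate S₂)).map Prod.fst).Perm (S₁ ++ S₂) ∧
    lcpMerge (annotate S₁) (annotate S₂) =
      annotate ((lcpMerge (annotate S₁) (annotate S₂)).map Prod.fst) := by
  have nil_le : ∀ x : List α, [] ≤ x := fun x => nil_strLe_aux x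
  obtain ⟨R, hR, hs, hp⟩ := lcpMerge_annotateFrom_aux [] S₁ S₂
    (List.pairwise_cons.2 ⟨fun x _ => nil_le x, h₁⟩)
    (List.pairwise_cons.2 ⟨fun x _ => nil_le x, h₂⟩)
  simp only [annotate_eq_aux, hR, annotateFrom_map_fst_aux]
  exact ⟨(List.pairwise_cons.1 hs).2, hp, trivial⟩
end

section
/- LCP-aware insertion sort is correct: given a sequence of n strings sharing a common prefix of length h̄, it outputs a lexicographically sorted permutation ⟨s_1,…,s_n⟩ of the input together with the correct LCP array ⟨h_2,…,h_n⟩, h_i = lcp(s_{i−1},s_i). -/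
/-- Replace the stored LCP annotation of the first element of an annotated list. -/
def setHeadAnn {α : Type*} (h : ℕ) : List (List α × ℕ) → List (List α × ℕ)
  | [] => []
  | (s, _) :: r => (s, h) :: r

/-- One insertion step of LCP-aware insertion sort, scanning right-to-left.
The state consists of the candidate `x`, its current LCP `h'` with the element just
right of the scanning gap, the pending LCP annotation `hi` between the element left
of the gap and the gap, the reversed left part `rl` of the sorted annotated array,
and the already shifted right part `right` (in normal order, whose head annotation is
still to be fixed).  Cases (per stored LCP `hi` vs. `h'`):
* `hi < h'`: the insertion point is found; `x` is inserted keeping annotation `hi`,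
  and the right neighbour's annotation becomes `h'` (no character comparisons);
* `hi > h'`: the position is skipped, shifting one element right (no comparisons);
* `hi = h'`: characters of `x` and the left string `s` from position `h' + 1` onward
  are compared (`m` matches, each counted together with its concluding order test as
  one ternary character comparison, so `m + 1` comparisons) and `h'` is increased by
  the number of matches; if `x ≥ s` the insertion point is found, otherwise the scan
  continues to the left.
Returns the new annotated array and the number of character comparisons. -/
def insGo {α : Type*} [LinearOrder α] (x : List α) :
    ℕ → ℕ → List (List α × ℕ) → List (List α × ℕ) → List (List α × ℕ) × ℕ
  | h', _, [], right => ((x, 0) :: setHeadAnn h' right, 0)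
  | h', hi, (s, g) :: rl, right =>
    if hi < h' then
      (((s, g) :: rl).reverse ++ (x, hi) :: setHeadAnn h' right, 0)
    else if h' < hi then
      insGo x h' g rl ((s, 0) :: setHeadAnn hi right)
    else
      let m := lcp (x.drop h') (s.drop h')
      if s.drop (h' + m) ≤ x.drop (h' + m) then
        (((s, g) :: rl).reverse ++ (x, h' + m) :: setHeadAnn h' right, m + 1)
      else
        let r := insGo x (h' + m) g rl ((s, 0) :: setHeadAnn hi right)
        (r.1, r.2 + m + 1)

/-- Insert the candidate `x` into the sorted annotated array `l` by the right-to-left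
scan of LCP-aware insertion sort, starting with candidate LCP `h̄` (the common prefix
length of all strings). -/
def lcpInsert {α : Type*} [LinearOrder α] (hbar : ℕ) (x : List α)
    (l : List (List α × ℕ)) : List (List α × ℕ) × ℕ :=
  insGo x hbar hbar l.reverse []

/-- LCP-aware insertion sort of a sequence of strings sharing a common prefix of
length `h̄`: strings are inserted one after another into the sorted prefix, which is
maintained together with its LCP array.  Returns the sorted annotated sequence and
the total number of character comparisons. -/
def lcpInsertionSort {α : Type*} [LinearOrder α] (hbar : ℕ)
    (l : List (List α)) : List (List α × ℕ) × ℕ :=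
  l.foldl (fun acc x =>
    let r := lcpInsert hbar x acc.1
    (r.1, acc.2 + r.2)) ([], 0)

section helpers
variable {α : Type*} [LinearOrder α]

theorem cons_le_cons_iff_aux (a b : α) (x y : List α) :
    a :: x ≤ b :: y ↔ a < b ∨ a = b ∧ x ≤ y := by
  rw [← not_lt, ← not_lt, List.cons_lt_cons_iff]
  rcases lt_trichotomy a b with h | h | h
  · simp [h, h.not_gt, h.ne']
  · simp [h]
  · simp [h, h.not_gt, h.ne']

theorem nil_le_aux (x : List α) : [] ≤ x := by
  rw [← not_lt]
  exact List.not_lt_nil x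

theorem lcp_skip : ∀ (x s r : List α), lcp x r < lcp s r → x ≤ r →
    x ≤ s ∧ lcp x s = lcp x r
  | [], s, r, _, _ => ⟨nil_le_aux s, by simp [lcp]⟩
  | a :: x, [], r, h, _ => by simp [lcp] at h
  | a :: x, b :: s, [], h, _ => by simp [lcp] at h
  | a :: x, b :: s, c :: r, h, hle => by
    have ih := lcp_skip x s r
    simp only [lcp, cons_le_cons_iff_aux] at *
    split_ifs at * <;> grind

theorem lcp_comm' : ∀ (x s : List α), lcp x s = lcp s x
  | [], [] => rfl
  | [], _ :: _ => rfl
  | _ :: _, [] => rfl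
  | a :: x, b :: s => by
    have ih := lcp_comm' x s
    simp only [lcp]
    grind

theorem lcp_ultra : ∀ (h : ℕ) (x s r : List α), h ≤ lcp x r → h ≤ lcp s r → h ≤ lcp x s
  | 0, _, _, _, _, _ => Nat.zero_le _
  | h + 1, [], s, r, h1, _ => by simp [lcp] at h1
  | h + 1, a :: x, [], r, _, h2 => by simp [lcp] at h2
  | h + 1, a :: x, b :: s, [], h1, _ => by simp [lcp] at h1
  | h + 1, a :: x, b :: s, c :: r, h1, h2 => by
    have ih := lcp_ultra h x s r
    simp only [lcp] at *
    split_ifs at * <;> grind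

theorem lcp_drop : ∀ (h : ℕ) (x s : List α), h ≤ lcp x s →
    h + lcp (x.drop h) (s.drop h) = lcp x s ∧ (s.drop h ≤ x.drop h ↔ s ≤ x)
  | 0, _, _, _ => by simp
  | h + 1, [], s, h1 => by simp [lcp] at h1
  | h + 1, a :: x, [], h1 => by simp [lcp] at h1
  | h + 1, a :: x, b :: s, h1 => by
    have ih := lcp_drop h x s
    simp only [lcp, List.drop_succ_cons, cons_le_cons_iff_aux] at *
    split_ifs at * <;> grind

theorem lcp_prefix : ∀ (p x s : List α), p <+: x → p <+: s → p.length ≤ lcp x s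
  | [], _, _, _, _ => Nat.zero_le _
  | a :: p, x, s, ⟨u, hu⟩, ⟨v, hv⟩ => by
    have ih := lcp_prefix p (p ++ u) (p ++ v) ⟨u, rfl⟩ ⟨v, rfl⟩
    subst hu hv
    simpa [lcp] using ih

/-- Sortedness together with correct annotations, on adjacent entries. -/
def AnnRel (a b : List α × ℕ) : Prop := a.1 ≤ b.1 ∧ b.2 = lcp a.1 b.1

theorem isChain_setHeadAnn (h : ℕ) (L : List (List α × ℕ)) :
    (setHeadAnn h L).IsChain AnnRel ↔ L.IsChain AnnRel := by
  rcases L with _ | ⟨⟨s, g⟩, _ | ⟨b, L⟩⟩ <;> simp [setHeadAnn, AnnRel]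

theorem map_setHeadAnn (h : ℕ) (L : List (List α × ℕ)) :
    (setHeadAnn h L).map Prod.fst = L.map Prod.fst := by
  rcases L with _ | ⟨⟨s, g⟩, L⟩ <;> simp [setHeadAnn]

theorem chain_ins (A B : List (List α × ℕ)) (s x : List α) (g h k : ℕ)
    (hA : (((s, g) :: A).reverse).IsChain AnnRel) (hB : B.IsChain AnnRel)
    (h1 : s ≤ x) (h2 : h = lcp s x)
    (h3 : ∀ r ∈ B.head?, x ≤ r.1 ∧ lcp x r.1 = k) :
    (((s, g) :: A).reverse ++ (x, h) :: setHeadAnn k B).IsChain AnnRel := by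
  rw [List.isChain_append]
  refine ⟨hA, ?_, ?_⟩
  · have := (isChain_setHeadAnn k B).2 hB
    rcases B with _ | ⟨⟨r, a⟩, B⟩
    · simp [setHeadAnn]
    · simp only [setHeadAnn] at *
      rw [List.isChain_cons_cons]
      have := h3 _ rfl
      exact ⟨⟨this.1, this.2.symm⟩, by assumption⟩
  · simp [AnnRel, h1, h2]

theorem insGo_spec (x : List α) : ∀ (rl right : List (List α × ℕ)) (h' hi : ℕ),
    (rl.reverse ++ setHeadAnn hi right).IsChain AnnRel →
    (∀ r ∈ right.head?, x ≤ r.1 ∧ lcp x r.1 = h') →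
    (right = [] → hi = h' ∧ ∀ s ∈ rl, h' ≤ lcp x s.1) →
    (insGo x h' hi rl right).1.IsChain AnnRel ∧
    ((insGo x h' hi rl right).1.map Prod.fst).Perm
      (x :: (rl.map Prod.fst ++ right.map Prod.fst)) := by
  intro rl
  induction rl with
  | nil =>
    intro right h' hi hc hr _
    simp only [insGo, List.map_cons, map_setHeadAnn, List.map_nil, List.nil_append,
      List.Perm.refl, and_true]
    simp only [List.reverse_nil, List.nil_append] at hc
    have := (isChain_setHeadAnn h' right).2 ((isChain_setHeadAnn hi right).1 hc)
    rcases right with _ | ⟨⟨r, a⟩, B⟩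
    · simp [setHeadAnn]
    · simp only [setHeadAnn] at *
      rw [List.isChain_cons_cons]
      have := hr _ rfl
      exact ⟨⟨this.1, this.2.symm⟩, by assumption⟩
  | cons sg rl ih =>
    obtain ⟨s, g⟩ := sg
    intro right h' hi hc hr hnil
    have hc' := List.isChain_append.1 hc
    obtain ⟨hA, hB, hAB⟩ := hc'
    rw [isChain_setHeadAnn] at hB
    have hsr : ∀ r ∈ right.head?, s ≤ r.1 ∧ hi = lcp s r.1 := by
      rcases right with _ | ⟨⟨r, a⟩, B⟩
      · simp
      · simpa [setHeadAnn, AnnRel] using hAB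
    have key : ∀ k, x ≤ s → lcp x s = k →
        (insGo x k g rl ((s, 0) :: setHeadAnn hi right)).1.IsChain AnnRel ∧
        ((insGo x k g rl ((s, 0) :: setHeadAnn hi right)).1.map Prod.fst).Perm
          (x :: (((s, g) :: rl).map Prod.fst ++ right.map Prod.fst)) := by
      intro k h1 h2
      have := ih ((s, 0) :: setHeadAnn hi right) k g (by simpa [setHeadAnn] using hc)
        (by simp [h1, h2]) (by simp)
      refine ⟨this.1, this.2.trans ?_⟩
      simp only [List.map_cons, map_setHeadAnn]
      exact (List.perm_middle).cons _
    have perm : ∀ a b, (((((s, g) :: rl).reverse ++ (x, a) :: setHeadAnn b right)).map Prod.fst).Perm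
          (x :: (((s, g) :: rl).map Prod.fst ++ right.map Prod.fst)) := by
      intro a b
      rw [List.map_append, List.map_cons, map_setHeadAnn]
      refine List.perm_middle.trans (List.Perm.cons _ (List.Perm.append_right _ ?_))
      exact (List.reverse_perm _).map _
    rw [insGo]
    split_ifs with c1 c2
    · refine ⟨?_, perm _ _⟩
      rcases right with _ | ⟨r, B⟩
      · have := hnil rfl; omega
      · have e1 := hr r rfl
        have e2 := hsr r rfl
        have := lcp_skip s x r.1 (by omega) e2.1
        exact chain_ins _ _ _ _ _ _ _ hA hB this.1 (by omega) hr
    · rcases right with _ | ⟨r, B⟩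
      · have := hnil rfl; omega
      · have e1 := hr r rfl
        have e2 := hsr r rfl
        have := lcp_skip x s r.1 (by omega) e1.1
        exact key _ this.1 (by omega)
    · have hxs : h' ≤ lcp x s := by
        rcases right with _ | ⟨r, B⟩
        · exact (hnil rfl).2 (s, g) (by simp)
        · have e1 := hr r rfl
          have e2 := hsr r rfl
          exact lcp_ultra h' x s r.1 (by omega) (by omega)
      have d1 := (lcp_drop h' x s hxs).1
      have d2 := (lcp_drop _ x s d1.le).2
      dsimp only
      split_ifs with c3
      · refine ⟨?_, perm _ _⟩
        exact chain_ins _ _ _ _ _ _ _ hA hB (d2.1 c3) (by rw [d1, lcp_comm']) hr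
      · exact key _ (le_of_not_ge fun h => c3 (d2.2 h)) d1.symm

theorem sort_spec (hbar : ℕ) (p : List α) (hp : p.length = hbar) (l : List (List α))
    (hl : ∀ s ∈ l, p <+: s) :
    (lcpInsertionSort hbar l).1.IsChain AnnRel ∧
    (((lcpInsertionSort hbar l).1.map Prod.fst).Perm l) := by
  induction l using List.reverseRecOn with
  | nil => simp [lcpInsertionSort]
  | append_singleton l x ih =>
    obtain ⟨i1, i2⟩ := ih (fun s hs => hl s (by simp [hs]))
    have e : (lcpInsertionSort hbar (l ++ [x])).1 =
        (insGo x hbar hbar (lcpInsertionSort hbar l).1.reverse []).1 := by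
      simp [lcpInsertionSort, lcpInsert]
    rw [e]
    have := insGo_spec x (lcpInsertionSort hbar l).1.reverse [] hbar hbar
      (by simpa [setHeadAnn] using i1) (by simp) (by
        intro _
        refine ⟨rfl, fun s hs => ?_⟩
        rw [← hp]
        refine lcp_prefix p _ _ (hl x (by simp)) (hl _ ?_)
        have : s.1 ∈ l := i2.subset (List.mem_map_of_mem (by simpa using hs))
        simp [this])
    refine ⟨this.1, this.2.trans ?_⟩
    simp only [List.map_nil, List.append_nil]
    refine List.Perm.trans (List.Perm.cons _ (((List.reverse_perm _).map _).trans i2)) ?_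
    exact (List.perm_append_singleton x l).symm

end helpers

/-- Correctness of LCP-aware insertion sort: given a sequence of strings sharing a
common prefix of length `h̄`, it outputs a lexicographically sorted permutation
`⟨s₁,…,s_n⟩` of the input together with the correct LCP array, i.e. each output
string is annotated with the LCP to its predecessor in the output. -/
theorem lcpInsertionSort_correct {α : Type*} [LinearOrder α]
    (hbar : ℕ) (p : List α) (hp : p.length = hbar)
    (l : List (List α)) (hcommon : ∀ s ∈ l, p <+: s) :
    (((lcpInsertionSort hbar l).1.map Prod.fst).Pairwise (· ≤ ·)) ∧
    (((lcpInsertionSort hbar l).1.map Prod.fst).Perm l) ∧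
    ((lcpInsertionSort hbar l).1.Chain' fun a b => b.2 = lcp a.1 b.1) := by
  obtain ⟨h1, h2⟩ := sort_spec hbar p hp l hcommon
  refine ⟨?_, h2, h1.imp fun _ _ h => h.2⟩
  rw [← List.isChain_iff_pairwise, List.isChain_map]
  exact h1.imp fun _ _ h => h.1
end
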